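/- arXiv:0803.0490 — 4 statements merged into one kernel-verified Lean document; each statement's English description precedes it below -/
import Mathlib

section
/- Let k₁ > 0, k₂ > 1, α > (k₂+1)²/4 and β ∈ ℝ. Define φ₀ : ℝ → ℝ by φ₀(x) = k₁x for x ≤ 0 and φ₀(x) = −k₂x for x ≥ 0. Then the planar system ẋ = y − φ₀(x), ẏ = β − αx − y has at most one limit cycle. -/
/-- `φ` is continuous and piecewise linear with `k` dropping sections: the `i`-th
dropping section is the interval `[a i, b i]` (indices `0,…,k-1`), on which `φ` is
affine with slope `-k₂`, while on each of the `k+1` complementary intervals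
`(-∞, a 0]`, `[b i, a (i+1)]`, `[b (k-1), ∞)` it is affine with slope `k₁`. -/
def IsPWL (k : ℕ) (k₁ k₂ : ℝ) (a b : ℕ → ℝ) (φ : ℝ → ℝ) : Prop :=
  Continuous φ ∧
  (∀ i, i < k → a i < b i) ∧
  (∀ i, i + 1 < k → b i < a (i + 1)) ∧
  (∃ c : ℕ → ℝ, ∀ i, i ≤ k → ∀ x : ℝ,
      (i = 0 ∨ b (i - 1) ≤ x) → (i = k ∨ x ≤ a i) → φ x = k₁ * x + c i) ∧
  (∃ d : ℕ → ℝ, ∀ i, i < k → ∀ x ∈ Set.Icc (a i) (b i), φ x = -k₂ * x + d i)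

/-- The vector field of system (1): `ẋ = y - φ(x)`, `ẏ = β - αx - y`. -/
def vecField (α β : ℝ) (φ : ℝ → ℝ) (p : ℝ × ℝ) : ℝ × ℝ :=
  (p.2 - φ p.1, β - α * p.1 - p.2)

/-- `Γ` is a periodic orbit of the planar vector field `F`: the image of a
nonconstant `T`-periodic (`T > 0`) solution of `γ' = F ∘ γ`. -/
def IsPeriodicOrbit (F : ℝ × ℝ → ℝ × ℝ) (Γ : Set (ℝ × ℝ)) : Prop :=
  ∃ γ : ℝ → ℝ × ℝ, ∃ T : ℝ, 0 < T ∧ (∀ t, γ (t + T) = γ t) ∧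
    (∀ t, HasDerivAt γ (F (γ t)) t) ∧ (∃ t, γ t ≠ γ 0) ∧ Γ = Set.range γ

/-- `Γ` is a limit cycle of `F`: a periodic orbit admitting an open neighborhood
in which it is the only periodic orbit. -/
def IsLimitCycle (F : ℝ × ℝ → ℝ × ℝ) (Γ : Set (ℝ × ℝ)) : Prop :=
  IsPeriodicOrbit F Γ ∧
  ∃ U : Set (ℝ × ℝ), IsOpen U ∧ Γ ⊆ U ∧
    ∀ Γ' : Set (ℝ × ℝ), IsPeriodicOrbit F Γ' → Γ' ⊆ U → Γ' = Γ


lemma hasDerivAt_maxsq (x : ℝ) : HasDerivAt (fun x : ℝ => (max 0 x)^2) (2 * max 0 x) x := by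
  rcases lt_trichotomy x 0 with h | h | h
  · rw [max_eq_left h.le]
    have : (fun x : ℝ => (max 0 x)^2) =ᶠ[nhds x] fun _ => 0 := by
      filter_upwards [Iio_mem_nhds h] with y hy
      rw [max_eq_left (le_of_lt hy)]; norm_num
    simpa using (hasDerivAt_const x (0:ℝ)).congr_of_eventuallyEq this
  · subst h
    rw [hasDerivAt_iff_isLittleO]
    simp only [max_self, sub_zero, mul_zero, smul_zero, ne_eq, OfNat.ofNat_ne_zero, not_false_eq_true, zero_pow]
    have h1 : (fun x : ℝ => x^2) =o[nhds 0] (fun x : ℝ => x) := by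
      simpa using Asymptotics.isLittleO_pow_id (𝕜 := ℝ) (n := 2) (by norm_num)
    refine Asymptotics.IsBigO.trans_isLittleO (Asymptotics.IsBigO.of_bound 1 ?_) h1
    refine Filter.Eventually.of_forall fun y => ?_
    simp only [Real.norm_eq_abs, one_mul, abs_pow]
    refine pow_le_pow_left₀ (abs_nonneg _) ?_ 2
    rcases le_total 0 y with h | h
    · rw [max_eq_right h]
    · rw [max_eq_left h]; simp
  · rw [max_eq_right h.le]
    have : (fun x : ℝ => (max 0 x)^2) =ᶠ[nhds x] fun y => y^2 := by
      filter_upwards [Ioi_mem_nhds h] with y hy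
      rw [max_eq_right (le_of_lt hy)]
    simpa using (hasDerivAt_pow 2 x).congr_of_eventuallyEq this

lemma right_deriv_max (y : ℝ → ℝ) (y' t : ℝ) (h : HasDerivAt y y' t) (h0 : y t = 0) :
    HasDerivWithinAt (fun s => max 0 (y s)) (max 0 y') (Set.Ici t) t := by
  rw [hasDerivWithinAt_iff_isLittleO]
  have h1 := (hasDerivAt_iff_isLittleO.1 h).mono (nhdsWithin_le_nhds (s := Set.Ici t))
  refine Asymptotics.IsBigO.trans_isLittleO (Asymptotics.IsBigO.of_bound 1 ?_) h1
  filter_upwards [self_mem_nhdsWithin] with s hs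
  have hs' : 0 ≤ s - t := sub_nonneg.2 hs
  simp only [h0, max_self, sub_zero, smul_eq_mul, one_mul, Real.norm_eq_abs]
  have : (s - t) * max 0 y' = max 0 ((s-t) * y') := by
    rw [mul_max_of_nonneg _ _ hs', mul_zero]
  rw [this]
  have := abs_max_sub_max_le_max 0 (y s) 0 ((s-t)*y')
  simpa using this

structure Prm where
  A : ℝ
  B : ℝ
  p : ℝ
  q : ℝ
  d : ℝ
  hA : 0 < A
  hB : 0 < B
  hp : 0 < p
  hq : 0 < q
  hd : 0 < d

namespace Prm
noncomputable section
variable (P : Prm)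

def m (u : ℝ) : ℝ := max 0 (-u - P.d)
def g (u : ℝ) : ℝ := P.q * u - (P.p - P.q) * P.m u
def F (u : ℝ) : ℝ := -P.B * u - (P.A + P.B) * P.m u
def G (u : ℝ) : ℝ := P.q * u^2 + (P.p - P.q) * (P.m u)^2
def e (u : ℝ) : ℝ := P.m u / (P.m u + P.d)
def R (u : ℝ) : ℝ := √(P.q + (P.p - P.q) * (P.e u)^2)
def Z (u : ℝ) : ℝ := u * P.R u
def k (u : ℝ) : ℝ := (P.q + (P.p - P.q) * P.e u) / P.R u
def W (u v : ℝ) : ℝ := P.G u + v^2 - v * P.F u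

lemma m_nonneg (u : ℝ) : 0 ≤ P.m u := le_max_left _ _
lemma m_right {u : ℝ} (h : -P.d ≤ u) : P.m u = 0 := max_eq_left (by linarith)
lemma m_left {u : ℝ} (h : u ≤ -P.d) : P.m u = -u - P.d := max_eq_right (by linarith)
lemma m_cont : Continuous P.m := by unfold m; fun_prop
lemma e_nonneg (u : ℝ) : 0 ≤ P.e u := div_nonneg (P.m_nonneg u) (by linarith [P.m_nonneg u, P.hd])
lemma e_lt (u : ℝ) : P.e u < 1 := by
  have := P.m_nonneg u
  have := P.hd
  unfold e
  rw [div_lt_one (by linarith)]; linarith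
lemma e_cont : Continuous P.e := by
  unfold e
  exact P.m_cont.div (P.m_cont.add continuous_const) fun u => by linarith [P.m_nonneg u, P.hd]
lemma u_e (u : ℝ) : u * P.e u = - P.m u := by
  have h1 := P.m_nonneg u
  have h2 := P.hd
  unfold e
  rcases le_total (-P.d) u with h | h
  · rw [P.m_right h]; simp
  · rw [P.m_left h]; 
    have : -u - P.d + P.d = -u := by ring
    rw [this]
    have : u ≠ 0 := by linarith
    field_simp
lemma R_arg (u : ℝ) : 0 < P.q + (P.p - P.q) * (P.e u)^2 := by
  have h1 := P.e_nonneg u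
  have h2 := P.e_lt u
  have := P.hp
  have := P.hq
  have h3 : (P.e u)^2 < 1 := by nlinarith
  nlinarith [mul_pos P.hq (sub_pos.2 h3), mul_nonneg P.hp.le (sq_nonneg (P.e u))]
lemma R_pos (u : ℝ) : 0 < P.R u := Real.sqrt_pos.2 (P.R_arg u)
lemma R_sq (u : ℝ) : P.R u ^ 2 = P.q + (P.p - P.q) * (P.e u)^2 := Real.sq_sqrt (P.R_arg u).le
lemma R_cont : Continuous P.R := by
  have := P.e_cont
  unfold R; fun_prop
lemma k_pos (u : ℝ) : 0 < P.k u := by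
  refine div_pos ?_ (P.R_pos u)
  have h1 := P.e_nonneg u
  have h2 := P.e_lt u
  nlinarith [mul_pos P.hq (sub_pos.2 h2), mul_nonneg P.hp.le h1]
lemma k_cont : Continuous P.k := by
  have := P.e_cont
  unfold k
  exact (by fun_prop : Continuous fun u => P.q + (P.p - P.q) * P.e u).div P.R_cont fun u => (P.R_pos u).ne'
lemma g_cont : Continuous P.g := by
  have := P.m_cont
  unfold g; fun_prop
lemma F_cont : Continuous P.F := by
  have := P.m_cont
  unfold F; fun_prop
lemma G_cont : Continuous P.G := by
  have := P.m_cont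
  unfold G; fun_prop
lemma Z_cont : Continuous P.Z := by
  have := P.R_cont
  unfold Z; fun_prop
lemma Z_sq (u : ℝ) : P.Z u ^ 2 = P.G u := by
  unfold Z G
  rw [mul_pow, R_sq]
  have := P.u_e u
  have : (u * P.e u)^2 = (P.m u)^2 := by rw [this]; ring
  linear_combination (P.p - P.q) * this
lemma k_Z (u : ℝ) : P.k u * P.Z u = P.g u := by
  have h := (P.R_pos u).ne'
  have := P.u_e u
  unfold k Z g
  field_simp
  linear_combination (P.p - P.q) * this
lemma G_deriv (u : ℝ) : HasDerivAt P.G (2 * P.g u) u := by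
  have h1 : HasDerivAt (fun u : ℝ => -u - P.d) (-1) u := ((hasDerivAt_id u).neg).sub_const _
  have h2 := (hasDerivAt_maxsq (-u - P.d)).comp u h1
  have h3 := ((hasDerivAt_pow 2 u).const_mul P.q).add (h2.const_mul (P.p - P.q))
  refine h3.congr_deriv ?_
  unfold g m
  norm_num; ring
lemma Z_deriv (u : ℝ) : HasDerivAt P.Z (P.k u) u := by
  have hd := P.hd
  rcases lt_or_ge u 0 with h | h
  · have h0 : ∀ y < 0, P.Z y = -√(P.G y) := by
      intro y hy
      rw [← P.Z_sq, Real.sqrt_sq_eq_abs, abs_of_neg, neg_neg]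
      exact mul_neg_of_neg_of_pos hy (P.R_pos y)
    have hz : P.Z u < 0 := mul_neg_of_neg_of_pos h (P.R_pos u)
    have hG : P.G u ≠ 0 := by
      rw [← P.Z_sq]; exact pow_ne_zero _ hz.ne
    have h1 := ((P.G_deriv u).sqrt hG).neg
    have h2 : P.Z =ᶠ[nhds u] (fun y => -√(P.G y)) := by
      filter_upwards [Iio_mem_nhds h] with y hy using h0 y hy
    refine (h1.congr_of_eventuallyEq h2).congr_deriv ?_
    have h3 : √(P.G u) = - P.Z u := by rw [h0 u h]; ring
    rw [h3, ← P.k_Z]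
    have := hz.ne
    field_simp
  · have he : ∀ y, -P.d < y → P.e y = 0 := fun y hy => by
      unfold e; rw [P.m_right hy.le]; simp
    have h2 : P.Z =ᶠ[nhds u] (fun y => y * √P.q) := by
      filter_upwards [Ioi_mem_nhds (show -P.d < u by linarith)] with y hy
      unfold Z R
      rw [he y hy]; simp
    refine (((hasDerivAt_id u).mul_const (√P.q)).congr_of_eventuallyEq h2).congr_deriv ?_
    unfold k R
    rw [he u (by linarith)]
    simp
lemma Z_mono : StrictMono P.Z := by
  refine strictMono_of_deriv_pos fun u => ?_
  rw [(P.Z_deriv u).deriv]; exact P.k_pos u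
lemma Z_right {u : ℝ} (h : -P.d ≤ u) : P.Z u = √P.q * u := by
  unfold Z R e
  rw [P.m_right h]; simp [mul_comm]
lemma F_right {u : ℝ} (h : -P.d ≤ u) : P.F u = -P.B * u := by
  unfold F
  rw [P.m_right h]; simp
lemma G_nonneg (u : ℝ) : 0 ≤ P.G u := by rw [← Z_sq]; positivity
lemma G_eq_zero {u : ℝ} (h : P.G u = 0) : u = 0 := by
  rw [← Z_sq] at h
  have := pow_eq_zero_iff (two_ne_zero) |>.1 h
  unfold Z at this
  exact (mul_eq_zero.1 this).resolve_right (P.R_pos u).ne'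
lemma Z_zero : P.Z 0 = 0 := by simp [Z]

/-- key ratio inequality -/
lemma ratio {u₁ u₂ : ℝ} (h2 : u₂ < -P.d) (h12 : u₂ < u₁) (h1 : u₁ < 0) :
    P.F u₂ * (-P.Z u₁) < P.F u₁ * (- P.Z u₂) := by
  have hA := P.hA
  have hB := P.hB
  have hp := P.hp
  have hq := P.hq
  have hd := P.hd
  have hz1 : 0 < - P.Z u₁ := by have := P.Z_mono h1; rw [P.Z_zero] at this; linarith
  have hz12 : - P.Z u₁ < - P.Z u₂ := by have := P.Z_mono h12; linarith
  have e2 := P.m_left h2.le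
  rcases le_or_gt (-P.d) u₁ with h | h
  · have hz := P.Z_mono h2
    rw [P.Z_right le_rfl] at hz
    have hF : P.F u₂ < P.B * P.d := by
      unfold F; rw [e2]; nlinarith
    rw [P.Z_right h, P.F_right h]
    have hs : 0 < √P.q := Real.sqrt_pos.2 hq
    have : P.F u₂ * √P.q < P.B * (-P.Z u₂) := by
      calc _ < P.B * P.d * √P.q := by gcongr
        _ = P.B * (√P.q * P.d) := by ring
        _ < _ := by gcongr; linarith
    nlinarith
  · have e1 := P.m_left h.le
    obtain ⟨s₁, hs1, rfl⟩ : ∃ s, 0 < s ∧ u₁ = -P.d - s := ⟨-P.d - u₁, by linarith, by ring⟩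
    obtain ⟨s₂, hs2, rfl⟩ : ∃ s, 0 < s ∧ u₂ = -P.d - s := ⟨-P.d - u₂, by linarith, by ring⟩
    have hs : s₁ < s₂ := by linarith
    have F1 : P.F (-P.d - s₁) = P.B * P.d - P.A * s₁ := by unfold F; rw [e1]; ring
    have F2 : P.F (-P.d - s₂) = P.B * P.d - P.A * s₂ := by unfold F; rw [e2]; ring
    have Z1 : (-P.Z (-P.d - s₁))^2 = P.q * P.d^2 + 2 * P.q * P.d * s₁ + P.p * s₁^2 := by
      rw [neg_sq, Z_sq]; unfold G; rw [e1]; ring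
    have Z2 : (-P.Z (-P.d - s₂))^2 = P.q * P.d^2 + 2 * P.q * P.d * s₂ + P.p * s₂^2 := by
      rw [neg_sq, Z_sq]; unfold G; rw [e2]; ring
    rw [F1, F2]
    generalize -P.Z (-P.d - s₁) = z1 at *
    generalize -P.Z (-P.d - s₂) = z2 at *
    have hF : P.A * s₁ < P.A * s₂ := by gcongr
    rcases le_or_gt 0 (P.B * P.d - P.A * s₁) with hf | hf
    · have : (P.B * P.d - P.A * s₂) * z1 < (P.B * P.d - P.A * s₁) * z1 := by gcongr
      have : (P.B * P.d - P.A * s₁) * z1 ≤ (P.B * P.d - P.A * s₁) * z2 := by gcongr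
      linarith
    · obtain ⟨x, hx⟩ : ∃ x, x = P.A * s₁ - P.B * P.d := ⟨_, rfl⟩
      obtain ⟨y, hy⟩ : ∃ x, x = P.A * s₂ - P.B * P.d := ⟨_, rfl⟩
      have hx0 : 0 < x := by linarith
      have hxy : x < y := by linarith
      have hy0 : 0 < y := hx0.trans hxy
      have k1 : x * s₂ < y * s₁ := by
        have : 0 < P.B * P.d * (s₂ - s₁) := by have := sub_pos.2 hs; positivity
        rw [hx, hy]; nlinarith
      have : x * z2 < y * z1 := by
        have hh : (x * z2)^2 < (y * z1)^2 := by
          rw [mul_pow, mul_pow, Z1, Z2]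
          have a1 : x^2 < y^2 := by gcongr
          have a2 : x^2 * s₂ < y^2 * s₁ := by
            calc x^2 * s₂ = x * (x * s₂) := by ring
              _ < x * (y * s₁) := by gcongr
              _ ≤ y * (y * s₁) := by gcongr
              _ = _ := by ring
          have a3 : x^2 * s₂^2 < y^2 * s₁^2 := by
            rw [← mul_pow, ← mul_pow]; gcongr
          have b1 := mul_lt_mul_of_pos_left a1 (show 0 < P.q * P.d^2 by positivity)
          have b2 := mul_lt_mul_of_pos_left a2 (show 0 < 2 * P.q * P.d by positivity)
          have b3 := mul_lt_mul_of_pos_left a3 hp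
          linarith
        exact lt_of_pow_lt_pow_left₀ 2 (by positivity) hh
      rw [hx, hy] at this
      linarith

/-- comparison at the same angle -/
lemma compare {u₁ u₂ r₁ r₂ c : ℝ} (hr1 : 0 < r₁) (hr : r₁ < r₂) (h1 : P.Z u₁ = r₁ * c)
    (h2 : P.Z u₂ = r₂ * c) :
    c * P.F u₁ * r₂ ≤ c * P.F u₂ * r₁ ∧ (u₂ < -P.d → c * P.F u₁ * r₂ < c * P.F u₂ * r₁) := by
  have hs : 0 < √P.q := Real.sqrt_pos.2 P.hq
  have hd := P.hd
  have hr2 : 0 < r₂ := hr1.trans hr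
  have key : u₂ < -P.d → c * P.F u₁ * r₂ < c * P.F u₂ * r₁ := by
    intro h
    have hz2 : P.Z u₂ < 0 := by
      rw [← P.Z_zero]; exact P.Z_mono (by linarith)
    have hc : c < 0 := by
      rw [h2] at hz2; by_contra hc; push Not at hc; have := mul_nonneg hr2.le hc; linarith
    have hu1 : u₁ < 0 := by
      rw [← P.Z_mono.lt_iff_lt, P.Z_zero, h1]; exact mul_neg_of_pos_of_neg hr1 hc
    have hu12 : u₂ < u₁ := by
      rw [← P.Z_mono.lt_iff_lt, h1, h2]; nlinarith
    have := P.ratio h hu12 hu1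
    rw [h1, h2] at this
    nlinarith
  refine ⟨?_, key⟩
  rcases lt_or_ge u₂ (-P.d) with h | h
  · exact (key h).le
  · have hu1 : -P.d ≤ u₁ := by
      rcases le_or_gt 0 c with hc | hc
      · have : 0 ≤ u₁ := by rw [← P.Z_mono.le_iff_le, P.Z_zero, h1]; positivity
        linarith
      · have : u₂ ≤ u₁ := by rw [← P.Z_mono.le_iff_le, h1, h2]; nlinarith
        linarith
    rw [P.Z_right hu1] at h1
    rw [P.Z_right h] at h2
    rw [P.F_right hu1, P.F_right h]
    have e1 : u₁ = r₁ * c / √P.q := by field_simp; linarith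
    have e2 : u₂ = r₂ * c / √P.q := by field_simp; linarith
    rw [e1, e2]
    apply le_of_eq; ring
end
end Prm

namespace Prm
noncomputable section
variable (P : Prm)

structure IsSol (u v : ℝ → ℝ) : Prop where
  hu : ∀ t, HasDerivAt u (v t - P.F (u t)) t
  hv : ∀ t, HasDerivAt v (-P.g (u t)) t

variable {P} {u v : ℝ → ℝ} 

lemma IsSol.cu (S : P.IsSol u v) : Continuous u :=
  continuous_iff_continuousAt.2 fun t => (S.hu t).continuousAt
lemma IsSol.cv (S : P.IsSol u v) : Continuous v :=
  continuous_iff_continuousAt.2 fun t => (S.hv t).continuousAt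

variable (P) in
lemma gF_bound : ∃ C : ℝ, ∀ u, |2 * P.g u * P.F u| ≤ C * P.G u := by
  set c := min P.p P.q with hc
  have hc0 : 0 < c := lt_min P.hp P.hq
  refine ⟨2 * (P.q + |P.p - P.q|) * (P.A + 2 * P.B) / c, fun u => ?_⟩
  have hA := P.hA
  have hB := P.hB
  have hp := P.hp
  have hq := P.hq
  have hd := P.hd
  have hm0 := P.m_nonneg u
  have hm : P.m u ≤ |u| := by
    unfold m
    refine max_le (abs_nonneg u) ?_
    linarith [neg_le_abs u]
  have hm2 : (P.m u)^2 ≤ u^2 := by rw [← sq_abs u]; gcongr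
  have h1 : |P.g u| ≤ (P.q + |P.p - P.q|) * |u| := by
    unfold g
    calc _ ≤ |P.q * u| + |(P.p - P.q) * P.m u| := abs_sub _ _
      _ = P.q * |u| + |P.p - P.q| * P.m u := by rw [abs_mul, abs_mul, abs_of_pos hq, abs_of_nonneg hm0]
      _ ≤ P.q * |u| + |P.p - P.q| * |u| := by gcongr
      _ = _ := by ring
  have h2 : |P.F u| ≤ (P.A + 2 * P.B) * |u| := by
    unfold F
    calc _ ≤ |-P.B * u| + |(P.A + P.B) * P.m u| := abs_sub _ _
      _ = P.B * |u| + (P.A + P.B) * P.m u := by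
        rw [abs_mul, abs_mul, abs_neg, abs_of_pos hB, abs_of_pos (by positivity : 0 < P.A + P.B), abs_of_nonneg hm0]
      _ ≤ P.B * |u| + (P.A + P.B) * |u| := by gcongr
      _ = _ := by ring
  have h3 : c * u^2 ≤ P.G u := by
    unfold G
    have a1 : c ≤ P.p := min_le_left _ _
    have a2 : c ≤ P.q := min_le_right _ _
    nlinarith [mul_nonneg (sub_nonneg.2 a1) (sq_nonneg (P.m u)), mul_nonneg (sub_nonneg.2 a2) (sub_nonneg.2 hm2)]
  calc |2 * P.g u * P.F u| = 2 * (|P.g u| * |P.F u|) := by rw [abs_mul, abs_mul]; norm_num; ring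
    _ ≤ 2 * (((P.q + |P.p - P.q|) * |u|) * ((P.A + 2 * P.B) * |u|)) := by gcongr
    _ = 2 * (P.q + |P.p - P.q|) * (P.A + 2 * P.B) / c * (c * u^2) := by
      rw [← sq_abs u]; field_simp
    _ ≤ _ := by gcongr

/-- the energy never vanishes unless always -/
lemma IsSol.energy_deriv (S : P.IsSol u v) (t : ℝ) :
    HasDerivAt (fun t => P.G (u t) + v t ^ 2) (-(2 * P.g (u t) * P.F (u t))) t := by
  have h1 := (P.G_deriv (u t)).comp t (S.hu t)
  refine (h1.add ((S.hv t).pow 2)).congr_deriv ?_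
  norm_num; ring

lemma IsSol.energy_zero (S : P.IsSol u v) {t₁ : ℝ} (h : P.G (u t₁) + v t₁ ^ 2 = 0) (t : ℝ) :
    u t = 0 ∧ v t = 0 := by
  obtain ⟨C, hC⟩ := P.gF_bound
  have hC0 : ∀ t, |2 * P.g (u t) * P.F (u t)| ≤ C * (P.G (u t) + v t^2) := by
    intro t
    have hG : 0 < P.G 1 := lt_of_le_of_ne (P.G_nonneg 1) fun h => by
      have := P.G_eq_zero h.symm; norm_num at this
    have : 0 ≤ C := by
      by_contra hc
      push Not at hc
      have := (abs_nonneg _).trans (hC 1)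
      nlinarith
    nlinarith [hC (u t), mul_nonneg this (sq_nonneg (v t))]
  have key : P.G (u t) + v t ^ 2 ≤ 0 := by
    rcases le_total t₁ t with ht | ht
    · have hder : ∀ s, HasDerivAt (fun t => (P.G (u t) + v t ^ 2) * Real.exp (-C * t))
        (-(2 * P.g (u s) * P.F (u s)) * Real.exp (-C * s) + (P.G (u s) + v s ^ 2) * (Real.exp (-C * s) * -C)) s := by
        intro s
        exact (S.energy_deriv s).mul (((hasDerivAt_id s).const_mul (-C)).exp.congr_deriv (by simp))
      have : Antitone (fun t => (P.G (u t) + v t ^ 2) * Real.exp (-C * t)) := by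
        refine antitone_of_deriv_nonpos (fun s => (hder s).differentiableAt) fun s => ?_
        rw [(hder s).deriv]
        have := Real.exp_pos (-C * s)
        have := (abs_le.1 (hC0 s)).1
        nlinarith
      have := this ht
      simp only [h, zero_mul] at this
      exact nonpos_of_mul_nonpos_left this (Real.exp_pos _)
    · have hder : ∀ s, HasDerivAt (fun t => (P.G (u t) + v t ^ 2) * Real.exp (C * t))
        (-(2 * P.g (u s) * P.F (u s)) * Real.exp (C * s) + (P.G (u s) + v s ^ 2) * (Real.exp (C * s) * C)) s := by
        intro s
        exact (S.energy_deriv s).mul (((hasDerivAt_id s).const_mul (C)).exp.congr_deriv (by simp))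
      have : Monotone (fun t => (P.G (u t) + v t ^ 2) * Real.exp (C * t)) := by
        refine monotone_of_deriv_nonneg (fun s => (hder s).differentiableAt) fun s => ?_
        rw [(hder s).deriv]
        have := Real.exp_pos (C * s)
        have := (abs_le.1 (hC0 s)).2
        nlinarith
      have := this ht
      simp only [h, zero_mul] at this
      exact nonpos_of_mul_nonpos_left this (Real.exp_pos _)
  have h1 := P.G_nonneg (u t)
  have h2 := sq_nonneg (v t)
  refine ⟨P.G_eq_zero (by linarith), ?_⟩
  exact pow_eq_zero_iff two_ne_zero |>.1 (by linarith : v t ^2 = 0)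

lemma IsSol.m_right_deriv (S : P.IsSol u v) (t : ℝ) :
    ∃ f, -P.B ≤ f ∧ f ≤ P.A ∧ 0 ≤ f * P.G (u t) - P.g (u t) * P.F (u t) ∧
      HasDerivWithinAt (fun s => P.F (u s)) (f * (v t - P.F (u t))) (Set.Ici t) t := by
  have hA := P.hA
  have hB := P.hB
  have hp := P.hp
  have hq := P.hq
  have hd := P.hd
  have hy : HasDerivAt (fun s => -u s - P.d) (-(v t - P.F (u t))) t := (S.hu t).neg.sub_const _
  have hF : ∀ w, HasDerivWithinAt (fun s => P.m (u s)) w (Set.Ici t) t →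
      HasDerivWithinAt (fun s => P.F (u s)) (-P.B * (v t - P.F (u t)) - (P.A + P.B) * w) (Set.Ici t) t := by
    intro w hw
    exact ((S.hu t).hasDerivWithinAt.const_mul (-P.B)).sub (hw.const_mul (P.A + P.B))
  rcases lt_trichotomy (u t) (-P.d) with h | h | h
  · refine ⟨P.A, by linarith, le_rfl, ?_, ?_⟩
    · have := P.m_left h.le
      obtain ⟨s, hs⟩ : ∃ s, s = P.m (u t) := ⟨_, rfl⟩
      have hs0 : 0 < s := by rw [hs, this]; linarith
      have hu : u t = -P.d - s := by linarith
      unfold G g F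
      rw [← hs, hu]
      have : P.A * (P.q * (-P.d - s) ^ 2 + (P.p - P.q) * s ^ 2) -
        (P.q * (-P.d - s) - (P.p - P.q) * s) * (-P.B * (-P.d - s) - (P.A + P.B) * s)
        = P.A * (P.q * P.d^2 + P.q * P.d * s) + P.B * P.d * (P.q * P.d + P.p * s) := by ring
      rw [this]; positivity
    · refine (hF (-(v t - P.F (u t))) ?_).congr_deriv (by ring)
      refine HasDerivAt.hasDerivWithinAt (hy.congr_of_eventuallyEq ?_)
      filter_upwards [S.cu.continuousAt.eventually (Iio_mem_nhds h)] with s hs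
      exact P.m_left (le_of_lt hs)
  · have hw := hF _ (right_deriv_max _ _ t hy (by rw [h]; ring))
    have hm := P.m_right h.ge
    have hK : ∀ f, -P.B ≤ f → 0 ≤ f * P.G (u t) - P.g (u t) * P.F (u t) := by
      intro f hf
      unfold G g F
      rw [hm, h]
      have : f * (P.q * (-P.d) ^ 2 + (P.p - P.q) * 0 ^ 2) -
        (P.q * -P.d - (P.p - P.q) * 0) * (-P.B * -P.d - (P.A + P.B) * 0) = (f + P.B) * (P.q * P.d^2) := by ring
      rw [this]
      have : 0 ≤ f + P.B := by linarith
      positivity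
    rcases le_total (v t - P.F (u t)) 0 with h0 | h0
    · rw [max_eq_right (by linarith)] at hw
      exact ⟨P.A, by linarith, le_rfl, hK _ (by linarith), hw.congr_deriv (by ring)⟩
    · rw [max_eq_left (by linarith)] at hw
      exact ⟨-P.B, le_rfl, by linarith, hK _ le_rfl, hw.congr_deriv (by ring)⟩
  · refine ⟨-P.B, le_rfl, by linarith, ?_, ?_⟩
    · unfold G g F
      rw [P.m_right h.le]
      apply le_of_eq; ring
    · refine (hF 0 ?_).congr_deriv (by ring)
      refine HasDerivAt.hasDerivWithinAt ((hasDerivAt_const t (0:ℝ)).congr_of_eventuallyEq ?_)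
      filter_upwards [S.cu.continuousAt.eventually (Ioi_mem_nhds h)] with s hs
      exact P.m_right (le_of_lt hs)

lemma IsSol.W_forward (S : P.IsSol u v) {t₁ t₂ : ℝ} (h : 0 < P.W (u t₁) (v t₁)) (h12 : t₁ ≤ t₂) :
    0 < P.W (u t₂) (v t₂) := by
  have hA := P.hA
  choose f hf1 hf2 hf3 hf4 using S.m_right_deriv
  set C := P.A + 1
  have hW : ∀ t, HasDerivWithinAt (fun s => -P.W (u s) (v s))
      (-(-f t * P.W (u t) (v t) + (f t * P.G (u t) - P.g (u t) * P.F (u t)))) (Set.Ici t) t := by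
    intro t
    have h1 := (S.energy_deriv t).hasDerivWithinAt (s := Set.Ici t)
    have h2 := (S.hv t).hasDerivWithinAt (s := Set.Ici t)
    refine ((h1.sub (h2.mul (hf4 t))).neg).congr_deriv ?_
    unfold W; ring
  have hB : ∀ t, HasDerivAt (fun t => - P.W (u t₁) (v t₁) * Real.exp (-C * (t - t₁)))
      (- P.W (u t₁) (v t₁) * (Real.exp (-C * (t - t₁)) * -C)) t := by
    intro t
    exact ((((hasDerivAt_id t).sub_const t₁).const_mul (-C)).exp.congr_deriv (by simp)).const_mul _
  have hc : Continuous (fun s => -P.W (u s) (v s)) := by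
    have := S.cu
    have := S.cv
    have := P.F_cont
    have := P.G_cont
    unfold W; fun_prop
  have := image_le_of_deriv_right_lt_deriv_boundary (f := fun s => -P.W (u s) (v s)) (a := t₁) (b := t₂)
    hc.continuousOn (fun x _ => hW x) (B := fun t => - P.W (u t₁) (v t₁) * Real.exp (-C * (t - t₁)))
    (by simp) hB (by
      intro t _ ht
      have hpos : 0 < P.W (u t) (v t) := by
        have := mul_pos h (Real.exp_pos (-C * (t - t₁)))
        linarith
      rw [← mul_assoc, ← ht]
      have := hf2 t
      have := hf3 t
      have : f t * P.W (u t) (v t) ≤ P.A * P.W (u t) (v t) := by gcongr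
      simp only [C]
      nlinarith) (Set.right_mem_Icc.2 h12)
  have := mul_pos h (Real.exp_pos (-C * (t₂ - t₁)))
  linarith

lemma IsSol.W_pos (S : P.IsSol u v) {T : ℝ} (hT : 0 < T) (pu : ∀ t, u (t + T) = u t)
    (pv : ∀ t, v (t + T) = v t) (hE : ∀ t, P.G (u t) + v t ^ 2 ≠ 0) (t : ℝ) :
    0 < P.W (u t) (v t) := by
  by_contra hcon
  have hN : ∀ (n : ℕ) t, u (t + n * T) = u t ∧ v (t + n * T) = v t := by
    intro n
    induction n with
    | zero => simp
    | succ n ih =>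
      intro t
      have : t + ((n+1 : ℕ) : ℝ) * T = (t + n * T) + T := by push_cast; ring
      rw [this, pu, pv]; exact ih t
  have hall : ∀ s, P.W (u s) (v s) ≤ 0 := by
    intro s
    by_contra hs
    push Not at hs
    obtain ⟨n, hn⟩ := exists_nat_ge ((s - t) / T)
    have : s ≤ t + n * T := by
      rw [div_le_iff₀ hT] at hn; linarith
    have := S.W_forward hs this
    rw [(hN n t).1, (hN n t).2] at this
    exact hcon this
  obtain ⟨c, _, hc⟩ := exists_hasDerivAt_eq_zero (f := v) hT S.cv.continuousOn
    (by have := pv 0; simpa using this.symm) (fun x _ => S.hv x)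
  have hg : P.g (u c) = 0 := by linarith
  rw [← P.k_Z] at hg
  have hz : P.Z (u c) = 0 := (mul_eq_zero.1 hg).resolve_left (P.k_pos _).ne'
  have hG : P.G (u c) = 0 := by rw [← P.Z_sq, hz]; norm_num
  have hu : u c = 0 := P.G_eq_zero hG
  have hw := hall c
  have hF : P.F (u c) = 0 := by
    rw [hu, P.F_right (by linarith [P.hd])]; ring
  apply hE c
  unfold W at hw
  rw [hF] at hw
  have := sq_nonneg (v c)
  linarith
end
end Prm

namespace Prm
noncomputable section
variable {P : Prm} {u v : ℝ → ℝ} 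

lemma prim (a : ℝ → ℝ) (ha : Continuous a) (c : ℝ) :
    ∃ L : ℝ → ℝ, L 0 = c ∧ ∀ t, HasDerivAt L (a t) t := by
  refine ⟨fun t => c + ∫ s in (0:ℝ)..t, a s, by simp, fun t => ?_⟩
  exact (intervalIntegral.integral_hasDerivAt_right (ha.intervalIntegrable _ _)
    (ha.stronglyMeasurableAtFilter _ _) ha.continuousAt).const_add c

lemma polar_init (x y : ℝ) (h : x^2 + y^2 ≠ 0) :
    ∃ L θ : ℝ, x = Real.exp L * Real.cos θ ∧ y = - (Real.exp L * Real.sin θ) := by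
  have h0 : (⟨x, -y⟩ : ℂ) ≠ 0 := by
    intro h1
    have hx := congrArg Complex.re h1
    have hy := congrArg Complex.im h1
    simp at hx hy
    apply h; rw [hx, hy]; norm_num
  have h1 := Complex.exp_log h0
  refine ⟨(Complex.log ⟨x, -y⟩).re, (Complex.log ⟨x, -y⟩).im, ?_, ?_⟩
  · rw [← Complex.exp_re, h1]
  · rw [← Complex.exp_im, h1]; simp

lemma const_of_deriv {X : ℝ → ℝ} (h : ∀ t, HasDerivAt X 0 t) (s t : ℝ) : X s = X t :=
  is_const_of_deriv_eq_zero (fun t => (h t).differentiableAt) (fun t => (h t).deriv) s t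

lemma IsSol.polar (S : P.IsSol u v) {T : ℝ} (hT : 0 < T) (pu : ∀ t, u (t + T) = u t)
    (pv : ∀ t, v (t + T) = v t) (hE : ∀ t, P.G (u t) + v t ^ 2 ≠ 0) :
    ∃ (L U V : ℝ → ℝ) (n : ℕ), 0 < n ∧ (∀ x, L (x + n * (2 * Real.pi)) = L x) ∧
      (∀ x, HasDerivAt L (-(P.Z (U x) * P.F (U x)) / P.W (U x) (V x)) x) ∧
      (∀ x, 0 < P.W (U x) (V x)) ∧ (∀ x, P.Z (U x) = Real.exp (L x) * Real.cos x) ∧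
      (∀ x, V x = -(Real.exp (L x) * Real.sin x)) ∧
      Set.range (fun t => (u t, v t)) = Set.range (fun x => (U x, V x)) := by
  have hW := S.W_pos hT pu pv hE
  have cu := S.cu
  have cv := S.cv
  have cF := P.F_cont
  have cG := P.G_cont
  have cZ := P.Z_cont
  have ck := P.k_cont
  set E : ℝ → ℝ := fun t => P.G (u t) + v t ^ 2 with hEdef
  have cE : Continuous E := by fun_prop
  have hE0 : ∀ t, 0 < E t := fun t =>
    lt_of_le_of_ne (add_nonneg (P.G_nonneg _) (sq_nonneg _)) (hE t).symm
  obtain ⟨L0, θ0, hx0, hy0⟩ := polar_init (P.Z (u 0)) (v 0) (by rw [P.Z_sq]; exact hE 0)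
  set a : ℝ → ℝ := fun t => -(P.k (u t) * P.Z (u t) * P.F (u t)) / E t with ha
  set b : ℝ → ℝ := fun t => P.k (u t) * P.W (u t) (v t) / E t with hb
  have cW : Continuous fun t => P.W (u t) (v t) := by unfold W; fun_prop
  have ca : Continuous a := Continuous.div (by fun_prop) cE fun t => hE t
  have cb : Continuous b := Continuous.div (by fun_prop) cE fun t => hE t
  have hb0 : ∀ t, 0 < b t := fun t => div_pos (mul_pos (P.k_pos _) (hW t)) (hE0 t)
  obtain ⟨L, hL0, hL⟩ := prim a ca L0
  obtain ⟨ψ, hψ0, hψ⟩ := prim b cb θ0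
  have hZ : ∀ t, HasDerivAt (fun t => P.Z (u t)) (a t * P.Z (u t) + b t * v t) t := by
    intro t
    refine ((P.Z_deriv (u t)).comp t (S.hu t)).congr_deriv ?_
    have h0 : E t ≠ 0 := hE t
    have h1 : E t = P.Z (u t)^2 + v t^2 := by rw [P.Z_sq]
    have h2 : P.W (u t) (v t) = E t - v t * P.F (u t) := by unfold W; ring
    simp only [ha, hb]
    rw [h2]
    field_simp
    linear_combination (- P.k (u t) * P.F (u t)) * h1
  have hV : ∀ t, HasDerivAt v (a t * v t - b t * P.Z (u t)) t := by
    intro t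
    refine (S.hv t).congr_deriv ?_
    have h0 : E t ≠ 0 := hE t
    have h2 : P.W (u t) (v t) = E t - v t * P.F (u t) := by unfold W; ring
    simp only [ha, hb]
    rw [h2, ← P.k_Z]
    field_simp
    ring
  have hX : ∀ t, HasDerivAt (fun t => Real.exp (-L t) * (P.Z (u t) * Real.cos (ψ t) - v t * Real.sin (ψ t))) 0 t := by
    intro t
    refine ((hL t).neg.exp.mul (((hZ t).mul (hψ t).cos).sub ((hV t).mul (hψ t).sin))).congr_deriv ?_
    simp only [Pi.sub_apply, Pi.mul_apply]
    ring
  have hY : ∀ t, HasDerivAt (fun t => Real.exp (-L t) * (P.Z (u t) * Real.sin (ψ t) + v t * Real.cos (ψ t))) 0 t := by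
    intro t
    refine ((hL t).neg.exp.mul (((hZ t).mul (hψ t).sin).add ((hV t).mul (hψ t).cos))).congr_deriv ?_
    simp only [Pi.add_apply, Pi.mul_apply]
    ring
  have hX1 : ∀ t, P.Z (u t) * Real.cos (ψ t) - v t * Real.sin (ψ t) = Real.exp (L t) := by
    intro t
    have := const_of_deriv hX t 0
    simp only [hx0, hy0, hL0, hψ0] at this
    have h2 : Real.exp (-L0) * (Real.exp L0 * Real.cos θ0 * Real.cos θ0 - -(Real.exp L0 * Real.sin θ0) * Real.sin θ0) = 1 := by
      rw [Real.exp_neg]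
      field_simp
      linarith [Real.sin_sq_add_cos_sq θ0]
    rw [h2, Real.exp_neg] at this
    field_simp at this
    linarith
  have hY1 : ∀ t, P.Z (u t) * Real.sin (ψ t) + v t * Real.cos (ψ t) = 0 := by
    intro t
    have := const_of_deriv hY t 0
    simp only [hx0, hy0, hL0, hψ0] at this
    have h2 : Real.exp (-L0) * (Real.exp L0 * Real.cos θ0 * Real.sin θ0 + -(Real.exp L0 * Real.sin θ0) * Real.cos θ0) = 0 := by
      ring
    rw [h2] at this
    exact (mul_eq_zero.1 this).resolve_left (Real.exp_pos _).ne'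
  have eZ : ∀ t, P.Z (u t) = Real.exp (L t) * Real.cos (ψ t) := by
    intro t
    linear_combination Real.cos (ψ t) * hX1 t + Real.sin (ψ t) * hY1 t
      - P.Z (u t) * (Real.sin_sq_add_cos_sq (ψ t))
  have eV : ∀ t, v t = -(Real.exp (L t) * Real.sin (ψ t)) := by
    intro t
    linear_combination -Real.sin (ψ t) * hX1 t + Real.cos (ψ t) * hY1 t
      - v t * (Real.sin_sq_add_cos_sq (ψ t))
  have eE : ∀ t, E t = Real.exp (L t) ^ 2 := by
    intro t
    simp only [hEdef]
    rw [← P.Z_sq, eZ, eV]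
    linear_combination Real.exp (L t) ^ 2 * (Real.sin_sq_add_cos_sq (ψ t))
  have pL : ∀ t, L (t + T) = L t := by
    intro t
    have : Real.exp (L (t + T)) ^ 2 = Real.exp (L t) ^ 2 := by
      rw [← eE, ← eE]; simp only [hEdef]; rw [pu, pv]
    exact Real.exp_injective ((pow_left_inj₀ (Real.exp_pos _).le (Real.exp_pos _).le two_ne_zero).1 this)
  have hmono : StrictMono ψ := strictMono_of_deriv_pos fun t => by rw [(hψ t).deriv]; exact hb0 t
  have cψ : Continuous ψ := continuous_iff_continuousAt.2 fun t => (hψ t).continuousAt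
  obtain ⟨κ, hκ⟩ : ∃ κ, κ = ψ T - ψ 0 := ⟨_, rfl⟩
  have hκ0 : 0 < κ := by have := hmono hT; linarith
  have pψ : ∀ t, ψ (t + T) = ψ t + κ := by
    intro t
    have h1 : ∀ t, HasDerivAt (fun t => ψ (t + T) - ψ t) 0 t := by
      intro t
      refine (((hψ (t + T)).comp_add_const t T).sub (hψ t)).congr_deriv ?_
      simp only [hb, hEdef]; rw [pu, pv]; ring
    have := const_of_deriv h1 t 0
    simp only [zero_add] at this
    linarith
  obtain ⟨n, hn0, hn⟩ : ∃ n : ℕ, 0 < n ∧ κ = n * (2 * Real.pi) := by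
    have hz : P.Z (u T) = P.Z (u 0) := by have := pu 0; rw [zero_add] at this; rw [this]
    have hv : v T = v 0 := by have := pv 0; rwa [zero_add] at this
    have hl : L T = L 0 := by have := pL 0; rwa [zero_add] at this
    rw [eZ, eZ, hl] at hz
    rw [eV, eV 0, hl] at hv
    have hc := mul_left_cancel₀ (Real.exp_pos _).ne' hz
    have hs := mul_left_cancel₀ (Real.exp_pos _).ne' (neg_injective hv)
    obtain ⟨j, hj⟩ := Real.Angle.angle_eq_iff_two_pi_dvd_sub.1 (Real.Angle.cos_sin_inj hc hs)
    rw [← hκ] at hj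
    have hj0 : 0 < j := by
      have : (0:ℝ) < j := by
        by_contra hcon
        push Not at hcon
        nlinarith [Real.pi_pos]
      exact_mod_cast this
    refine ⟨j.toNat, by omega, ?_⟩
    have : ((j.toNat : ℕ) : ℝ) = (j : ℝ) := by
      exact_mod_cast Int.toNat_of_nonneg hj0.le
    rw [this, hj]; ring
  have hup : ∀ n : ℕ, ψ (n * T) = ψ 0 + n * κ := by
    intro n
    induction n with
    | zero => simp
    | succ n ih =>
      have : ((n+1 : ℕ) : ℝ) * T = n * T + T := by push_cast; ring
      rw [this, pψ, ih]; push_cast; ring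
  have hdn : ∀ n : ℕ, ψ (-(n * T)) = ψ 0 - n * κ := by
    intro n
    induction n with
    | zero => simp
    | succ n ih =>
      have := pψ (-(((n+1 : ℕ) : ℝ) * T))
      have h2 : -(((n+1 : ℕ) : ℝ) * T) + T = -(n * T) := by push_cast; ring
      rw [h2, ih] at this
      push_cast at this ⊢; linarith
  have hsurj : Function.Surjective ψ := by
    intro y
    refine mem_range_of_exists_le_of_exists_ge cψ ?_ ?_
    · obtain ⟨j, hj⟩ := exists_nat_ge ((ψ 0 - y) / κ)
      rw [div_le_iff₀ hκ0] at hj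
      exact ⟨_, by rw [hdn j]; linarith⟩
    · obtain ⟨j, hj⟩ := exists_nat_ge ((y - ψ 0) / κ)
      rw [div_le_iff₀ hκ0] at hj
      exact ⟨_, by rw [hup j]; linarith⟩
  let Ψ := hmono.orderIsoOfSurjective ψ hsurj
  obtain ⟨τ, hτc, hτ⟩ : ∃ τ : ℝ → ℝ, Continuous τ ∧ ∀ x, ψ (τ x) = x :=
    ⟨Ψ.symm, Ψ.symm.continuous, fun x => Ψ.apply_symm_apply x⟩
  have hτ' : ∀ t, τ (ψ t) = t := fun t => hmono.injective (hτ _)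
  have dτ : ∀ x, HasDerivAt τ (b (τ x))⁻¹ x := fun x =>
    HasDerivAt.of_local_left_inverse hτc.continuousAt (hψ _) (hb0 _).ne' (Filter.Eventually.of_forall hτ)
  refine ⟨fun x => L (τ x), fun x => u (τ x), fun x => v (τ x), n, hn0, ?_, ?_, fun x => hW _, ?_, ?_, ?_⟩
  · intro x
    have : τ (x + n * (2 * Real.pi)) = τ x + T := by
      apply hmono.injective
      rw [hτ, pψ, hτ, hn]
    simp only [this, pL]
  · intro x
    refine ((hL (τ x)).comp x (dτ x)).congr_deriv ?_
    simp only [ha, hb]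
    have h1 : E (τ x) ≠ 0 := hE (τ x)
    have h2 := (P.k_pos (u (τ x))).ne'
    have h3 := (hW (τ x)).ne'
    field_simp
  · intro x
    simp only [eZ, hτ]
  · intro x
    have := eV (τ x)
    rwa [hτ] at this
  · ext w
    constructor
    · rintro ⟨t, rfl⟩
      exact ⟨ψ t, by simp only [hτ']⟩
    · rintro ⟨x, rfl⟩
      exact ⟨τ x, rfl⟩

/-- One-sided comparison. -/
lemma le_of_polar {L₁ U₁ V₁ L₂ U₂ V₂ : ℝ → ℝ} {N : ℝ} (hN : 0 < N)
    (p1 : ∀ x, L₁ (x + N) = L₁ x) (p2 : ∀ x, L₂ (x + N) = L₂ x)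
    (d1 : ∀ x, HasDerivAt L₁ (-(P.Z (U₁ x) * P.F (U₁ x)) / P.W (U₁ x) (V₁ x)) x)
    (d2 : ∀ x, HasDerivAt L₂ (-(P.Z (U₂ x) * P.F (U₂ x)) / P.W (U₂ x) (V₂ x)) x)
    (W1 : ∀ x, 0 < P.W (U₁ x) (V₁ x)) (W2 : ∀ x, 0 < P.W (U₂ x) (V₂ x))
    (Z1 : ∀ x, P.Z (U₁ x) = Real.exp (L₁ x) * Real.cos x)
    (Z2 : ∀ x, P.Z (U₂ x) = Real.exp (L₂ x) * Real.cos x)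
    (V1 : ∀ x, V₁ x = -(Real.exp (L₁ x) * Real.sin x))
    (V2 : ∀ x, V₂ x = -(Real.exp (L₂ x) * Real.sin x)) (x : ℝ) : L₂ x ≤ L₁ x := by
  by_contra hcon
  push Not at hcon
  have per : ∀ (f : ℝ → ℝ), (∀ x, f (x + N) = f x) → ∀ x y, ∃ y', y ≤ y' ∧ f y' = f x := by
    intro f hf x y
    have hper : Function.Periodic f N := hf
    obtain ⟨j, hj⟩ := exists_nat_ge ((y - x) / N)
    rw [div_le_iff₀ hN] at hj
    exact ⟨x + j * N, by linarith, hper.nat_mul j x⟩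
  have cmp : ∀ x, L₁ x < L₂ x →
      -(P.Z (U₂ x) * P.F (U₂ x)) / P.W (U₂ x) (V₂ x) ≤ -(P.Z (U₁ x) * P.F (U₁ x)) / P.W (U₁ x) (V₁ x) ∧
      (U₂ x < -P.d →
      -(P.Z (U₂ x) * P.F (U₂ x)) / P.W (U₂ x) (V₂ x) < -(P.Z (U₁ x) * P.F (U₁ x)) / P.W (U₁ x) (V₁ x)) := by
    intro x hx
    have hr1 := Real.exp_pos (L₁ x)
    have hr2 := Real.exp_pos (L₂ x)
    obtain ⟨c1, c2⟩ := P.compare hr1 (Real.exp_lt_exp.2 hx) (Z1 x) (Z2 x)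
    have w1 : P.W (U₁ x) (V₁ x) = Real.exp (L₁ x)^2 + Real.exp (L₁ x) * Real.sin x * P.F (U₁ x) := by
      unfold W; rw [← P.Z_sq, Z1, V1]
      linear_combination Real.exp (L₁ x) ^ 2 * (Real.sin_sq_add_cos_sq x)
    have w2 : P.W (U₂ x) (V₂ x) = Real.exp (L₂ x)^2 + Real.exp (L₂ x) * Real.sin x * P.F (U₂ x) := by
      unfold W; rw [← P.Z_sq, Z2, V2]
      linear_combination Real.exp (L₂ x) ^ 2 * (Real.sin_sq_add_cos_sq x)
    have e0 : -(P.Z (U₁ x) * P.F (U₁ x)) * P.W (U₂ x) (V₂ x) - -(P.Z (U₂ x) * P.F (U₂ x)) * P.W (U₁ x) (V₁ x)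
        = Real.exp (L₁ x) * Real.exp (L₂ x) * (Real.cos x * P.F (U₂ x) * Real.exp (L₁ x) - Real.cos x * P.F (U₁ x) * Real.exp (L₂ x)) := by
      rw [w1, w2, Z1, Z2]; ring
    have hr := mul_pos hr1 hr2
    constructor
    · rw [div_le_div_iff₀ (W2 x) (W1 x)]
      have := mul_nonneg hr.le (sub_nonneg.2 c1)
      linarith
    · intro h
      rw [div_lt_div_iff₀ (W2 x) (W1 x)]
      have := mul_pos hr (sub_pos.2 (c2 h))
      linarith
  have dQ : ∀ x, HasDerivAt (fun x => (max 0 (L₂ x - L₁ x))^2) (2 * max 0 (L₂ x - L₁ x) *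
      (-(P.Z (U₂ x) * P.F (U₂ x)) / P.W (U₂ x) (V₂ x) - -(P.Z (U₁ x) * P.F (U₁ x)) / P.W (U₁ x) (V₁ x))) x :=
    fun x => (hasDerivAt_maxsq _).comp x ((d2 x).sub (d1 x))
  have aQ : Antitone (fun x => (max 0 (L₂ x - L₁ x))^2) := by
    refine antitone_of_deriv_nonpos (fun s => (dQ s).differentiableAt) fun s => ?_
    rw [(dQ s).deriv]
    rcases le_or_gt (L₂ s - L₁ s) 0 with h | h
    · rw [max_eq_left h]; simp
    · have := (cmp s (by linarith)).1
      have h3 := le_max_left 0 (L₂ s - L₁ s)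
      nlinarith
  have perQ : ∀ x, (fun x => (max 0 (L₂ x - L₁ x))^2) (x + N) = (fun x => (max 0 (L₂ x - L₁ x))^2) x := by
    intro x; simp only [p1, p2]
  have constQ : ∀ y, (max 0 (L₂ y - L₁ y))^2 = (max 0 (L₂ x - L₁ x))^2 := by
    intro y
    apply le_antisymm
    · obtain ⟨y', h1, h2⟩ := per (fun x => (max 0 (L₂ x - L₁ x))^2) perQ y x
      have := aQ h1
      simp only [h2] at this; exact this
    · obtain ⟨y', h1, h2⟩ := per (fun x => (max 0 (L₂ x - L₁ x))^2) perQ x y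
      have := aQ h1
      simp only [h2] at this; exact this
  have hpos : ∀ y, L₁ y < L₂ y := by
    intro y
    by_contra h
    push Not at h
    have := constQ y
    rw [max_eq_left (by linarith), max_eq_right (by linarith)] at this
    have : 0 < (L₂ x - L₁ x)^2 := by have := sub_pos.2 hcon; positivity
    linarith
  have hU : ∀ y, -P.d ≤ U₂ y := by
    intro y
    by_contra h
    push Not at h
    have h1 := (cmp y (hpos y)).2 h
    have h2 : HasDerivAt (fun x => (max 0 (L₂ x - L₁ x))^2) 0 y := by
      have : (fun x => (max 0 (L₂ x - L₁ x))^2) = fun _ => (max 0 (L₂ x - L₁ x))^2 := funext constQ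
      rw [this]; exact hasDerivAt_const _ _
    have h3 := (dQ y).unique h2
    rw [max_eq_right (by linarith [hpos y])] at h3
    have := mul_pos (sub_pos.2 (hpos y)) (sub_pos.2 h1)
    nlinarith
  have hs : 0 < √P.q := Real.sqrt_pos.2 P.hq
  have hB := P.hB
  have e2 : ∀ y, -(P.Z (U₂ y) * P.F (U₂ y)) / P.W (U₂ y) (V₂ y) = P.B * √P.q * (U₂ y)^2 / P.W (U₂ y) (V₂ y) := by
    intro y
    rw [P.Z_right (hU y), P.F_right (hU y)]; ring
  have mono : Monotone L₂ := by
    refine monotone_of_deriv_nonneg (fun s => (d2 s).differentiableAt) fun s => ?_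
    rw [(d2 s).deriv, e2]
    have := W2 s
    positivity
  have const : ∀ y, L₂ y = L₂ 0 := by
    intro y
    apply le_antisymm
    · obtain ⟨y', h1, h2⟩ := per _ p2 0 y
      have := mono h1
      rwa [h2] at this
    · obtain ⟨y', h1, h2⟩ := per _ p2 y 0
      have := mono h1
      rwa [h2] at this
  have h2 : HasDerivAt L₂ 0 0 := by
    have : L₂ = fun _ => L₂ 0 := funext const
    rw [this]; exact hasDerivAt_const _ _
  have h3 := (d2 0).unique h2
  rw [e2] at h3
  have hz := Z2 0
  have hne : U₂ 0 ≠ 0 := by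
    intro h
    rw [h, P.Z_zero] at hz
    simp at hz
    exact (Real.exp_pos _).ne hz
  have := W2 0
  have : 0 < P.B * √P.q * (U₂ 0)^2 / P.W (U₂ 0) (V₂ 0) := by positivity
  linarith

theorem unique {u₁ v₁ u₂ v₂ : ℝ → ℝ} (S1 : P.IsSol u₁ v₁) (S2 : P.IsSol u₂ v₂) {T₁ T₂ : ℝ}
    (hT1 : 0 < T₁) (hT2 : 0 < T₂) (pu1 : ∀ t, u₁ (t + T₁) = u₁ t) (pv1 : ∀ t, v₁ (t + T₁) = v₁ t)
    (pu2 : ∀ t, u₂ (t + T₂) = u₂ t) (pv2 : ∀ t, v₂ (t + T₂) = v₂ t)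
    (n1 : ∃ t, (u₁ t, v₁ t) ≠ (u₁ 0, v₁ 0)) (n2 : ∃ t, (u₂ t, v₂ t) ≠ (u₂ 0, v₂ 0)) :
    Set.range (fun t => (u₁ t, v₁ t)) = Set.range (fun t => (u₂ t, v₂ t)) := by
  have hE : ∀ {u v : ℝ → ℝ}, P.IsSol u v → (∃ t, (u t, v t) ≠ (u 0, v 0)) →
      ∀ t, P.G (u t) + v t ^ 2 ≠ 0 := by
    rintro u v S ⟨s, hs⟩ t h
    have := S.energy_zero h
    apply hs
    rw [(this s).1, (this s).2, (this 0).1, (this 0).2]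
  obtain ⟨L₁, U₁, V₁, n₁, hn1, p1, d1, W1, Z1, V1, r1⟩ := S1.polar hT1 pu1 pv1 (hE S1 n1)
  obtain ⟨L₂, U₂, V₂, n₂, hn2, p2, d2, W2, Z2, V2, r2⟩ := S2.polar hT2 pu2 pv2 (hE S2 n2)
  have hpi := Real.pi_pos
  have hN : (0:ℝ) < n₁ * n₂ * (2 * Real.pi) := by positivity
  have q1 : ∀ x, L₁ (x + n₁ * n₂ * (2 * Real.pi)) = L₁ x := by
    intro x
    have : Function.Periodic L₁ (n₁ * (2 * Real.pi)) := p1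
    have := this.nat_mul n₂ x
    rw [← this]; congr 1; ring
  have q2 : ∀ x, L₂ (x + n₁ * n₂ * (2 * Real.pi)) = L₂ x := by
    intro x
    have : Function.Periodic L₂ (n₂ * (2 * Real.pi)) := p2
    have := this.nat_mul n₁ x
    rw [← this]; congr 1; ring
  have hL : ∀ x, L₁ x = L₂ x := fun x => le_antisymm
    (le_of_polar hN q2 q1 d2 d1 W2 W1 Z2 Z1 V2 V1 x) (le_of_polar hN q1 q2 d1 d2 W1 W2 Z1 Z2 V1 V2 x)
  have hV : ∀ x, V₁ x = V₂ x := fun x => by rw [V1, V2, hL]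
  have hU : ∀ x, U₁ x = U₂ x := fun x => P.Z_mono.injective (by rw [Z1, Z2, hL])
  rw [r1, r2]
  simp only [hU, hV]
end
end Prm

namespace Prm
lemma orbits_eq (P : Prm) (X f : ℝ × ℝ → ℝ × ℝ) (hf : Function.Injective f) (σ : ℝ) (hσ : σ = 1 ∨ σ = -1)
    (H : ∀ γ : ℝ → ℝ × ℝ, (∀ t, HasDerivAt γ (X (γ t)) t) →
      P.IsSol (fun t => (f (γ (σ * t))).1) (fun t => (f (γ (σ * t))).2))
    {Γ₁ Γ₂ : Set (ℝ × ℝ)} (h1 : IsPeriodicOrbit X Γ₁) (h2 : IsPeriodicOrbit X Γ₂) : Γ₁ = Γ₂ := by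
  have hσ2 : σ * σ = 1 := by rcases hσ with h | h <;> rw [h] <;> norm_num
  obtain ⟨γ, T, hT, hp, hd, ⟨s, hs⟩, rfl⟩ := h1
  obtain ⟨γ', T', hT', hp', hd', ⟨s', hs'⟩, rfl⟩ := h2
  have per : ∀ (γ : ℝ → ℝ × ℝ) (T : ℝ), (∀ t, γ (t + T) = γ t) → ∀ t, γ (σ * (t + T)) = γ (σ * t) := by
    intro γ T h t
    rcases hσ with rfl | rfl
    · simpa using h t
    · have := h (-1 * (t + T))
      rw [← this]; congr 1; ring
  have nc : ∀ (γ : ℝ → ℝ × ℝ) (s : ℝ), γ s ≠ γ 0 →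
      ∃ t, ((f (γ (σ * t))).1, (f (γ (σ * t))).2) ≠ ((f (γ (σ * 0))).1, (f (γ (σ * 0))).2) := by
    intro γ s h
    refine ⟨σ * s, fun h' => h ?_⟩
    simp only [Prod.mk.eta] at h'
    have := hf h'
    rwa [← mul_assoc, hσ2, one_mul, mul_zero] at this
  have rng : ∀ γ : ℝ → ℝ × ℝ, Set.range (fun t => ((f (γ (σ * t))).1, (f (γ (σ * t))).2)) = f '' Set.range γ := by
    intro γ
    ext w
    constructor
    · rintro ⟨t, rfl⟩
      exact ⟨_, ⟨σ * t, rfl⟩, rfl⟩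
    · rintro ⟨_, ⟨t, rfl⟩, rfl⟩
      refine ⟨σ * t, ?_⟩
      simp only [← mul_assoc, hσ2, one_mul, Prod.mk.eta]
  have key := unique (H γ hd) (H γ' hd') hT hT'
    (fun t => by simp only [per γ T hp]) (fun t => by simp only [per γ T hp])
    (fun t => by simp only [per γ' T' hp']) (fun t => by simp only [per γ' T' hp'])
    (nc γ s hs) (nc γ' s' hs')
  rw [rng, rng] at key
  exact hf.image_injective key

lemma no_cycle_of_homog (X : ℝ × ℝ → ℝ × ℝ) (hX : ∀ l : ℝ, 0 < l → ∀ w, X (l • w) = l • X w)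
    {Γ : Set (ℝ × ℝ)} (h : IsLimitCycle X Γ) : False := by
  obtain ⟨⟨γ, T, hT, hp, hd, ⟨s, hs⟩, rfl⟩, U, hU, hsub, huniq⟩ := h
  have hc : Continuous γ := continuous_iff_continuousAt.2 fun t => (hd t).continuousAt
  have hcomp : IsCompact (Set.range γ) :=
    Function.Periodic.compact_of_continuous (f := γ) (c := T) hp hT.ne' hc
  have hev : ∀ᶠ l : ℝ in nhds 1, ∀ w ∈ Set.range γ, l • w ∈ U := by
    refine hcomp.eventually_forall_of_forall_eventually fun w hw => ?_
    have : Continuous fun z : ℝ × (ℝ × ℝ) => z.1 • z.2 := by fun_prop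
    refine this.continuousAt.eventually ?_
    simp only [one_smul]
    exact hU.mem_nhds (hsub hw)
  obtain ⟨l, hl, hl1⟩ : ∃ l : ℝ, (∀ w ∈ Set.range γ, l • w ∈ U) ∧ 1 < l :=
    ((hev.filter_mono nhdsWithin_le_nhds).and (self_mem_nhdsWithin (s := Set.Ioi (1:ℝ)))).exists
  have hl0 : 0 < l := by linarith
  have heq : Set.range (fun t => l • γ t) = Set.range γ := by
    apply huniq
    · refine ⟨fun t => l • γ t, T, hT, fun t => by simp only [hp], fun t => ?_, ⟨s, fun h => hs ?_⟩, rfl⟩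
      · rw [hX l hl0]; exact (hd t).const_smul l
      · exact smul_right_injective _ hl0.ne' h
    · rintro _ ⟨t, rfl⟩
      exact hl _ ⟨t, rfl⟩
  obtain ⟨_, ⟨t0, rfl⟩, hmax⟩ := hcomp.exists_isMaxOn ⟨γ 0, 0, rfl⟩ continuous_norm.continuousOn
  have h1 : l • γ t0 ∈ Set.range γ := by rw [← heq]; exact ⟨t0, rfl⟩
  have h2 := hmax h1
  simp only [Set.mem_setOf_eq, norm_smul, Real.norm_eq_abs, abs_of_pos hl0] at h2
  have h3 : ‖γ t0‖ ≤ 0 := by nlinarith [norm_nonneg (γ t0)]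
  have h4 : ∀ t, γ t = 0 := fun t => norm_le_zero_iff.1 ((hmax ⟨t, rfl⟩ : ‖γ t‖ ≤ ‖γ t0‖).trans h3)
  exact hs (by rw [h4, h4])

end Prm

/-- The local model near one corner point (Lemma 4.1): the system
`ẋ = y - φ₀(x)`, `ẏ = β - αx - y` with `φ₀(x) = k₁x` for `x ≤ 0` and
`φ₀(x) = -k₂x` for `x ≥ 0` has at most one limit cycle. -/
theorem at_most_one_limit_cycle_corner_model
    (k₁ k₂ α β : ℝ) (hk₁ : 0 < k₁) (hk₂ : 1 < k₂)
    (hα : (k₂ + 1) ^ 2 / 4 < α) :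
    ∀ Γ Γ' : Set (ℝ × ℝ),
      IsLimitCycle (vecField α β (fun x => if x ≤ 0 then k₁ * x else -k₂ * x)) Γ →
      IsLimitCycle (vecField α β (fun x => if x ≤ 0 then k₁ * x else -k₂ * x)) Γ' →
      Γ = Γ' := by
  intro Γ Γ' h h'
  have hq : 0 < α - k₂ := by nlinarith [sq_nonneg (k₂ - 1)]
  have hp : 0 < α + k₁ := by linarith
  rcases lt_trichotomy β 0 with hβ | hβ | hβ
  · let P : Prm := ⟨k₂ - 1, 1 + k₁, α - k₂, α + k₁, -β / (α + k₁), by linarith, by linarith, hq, hp,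
      div_pos (by linarith) hp⟩
    obtain ⟨d, hd⟩ : ∃ d, d = -β / (α + k₁) := ⟨_, rfl⟩
    have hdβ : (α + k₁) * d = -β := by rw [hd]; field_simp
    refine P.orbits_eq _ (fun w => (-(w.1 + d), w.2 + w.1 + (d + k₁ * d))) ?_ (-1) (Or.inr rfl) ?_ h.1 h'.1
    · rintro ⟨x, y⟩ ⟨x', y'⟩ hxy
      simp only [Prod.mk.injEq] at hxy ⊢
      exact ⟨by linarith [hxy.1], by linarith [hxy.1, hxy.2]⟩
    · intro γ hγ
      have hc : ∀ t, HasDerivAt (fun t => γ (-1 * t)) (-(vecField α β (fun x => if x ≤ 0 then k₁ * x else -k₂ * x) (γ (-1 * t)))) t := by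
        intro t
        have h1 : HasDerivAt (fun t : ℝ => -1 * t) (-1) t := by
          simpa using (hasDerivAt_id t).const_mul (-1)
        exact ((hγ (-1 * t)).scomp t h1).congr_deriv (by simp)
      have h1 : ∀ t, HasDerivAt (fun t => (γ (-1 * t)).1) _ t := fun t => (hc t).fst
      have h2 : ∀ t, HasDerivAt (fun t => (γ (-1 * t)).2) _ t := fun t => (hc t).snd
      constructor
      · intro t
        refine ((h1 t).add_const d).neg.congr_deriv ?_
        simp only [vecField, Prm.F, Prm.m, P, ← hd, Prod.fst_neg]
        have : -(-((γ (-1 * t)).1 + d)) - d = (γ (-1 * t)).1 := by ring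
        rw [this]
        split_ifs with hx
        · rw [max_eq_left hx]; ring
        · rw [max_eq_right (by linarith)]; ring
      · intro t
        refine (((h2 t).add (h1 t)).add_const (d + k₁ * d)).congr_deriv ?_
        simp only [vecField, Prm.g, Prm.m, P, ← hd, Prod.fst_neg, Prod.snd_neg]
        have : -(-((γ (-1 * t)).1 + d)) - d = (γ (-1 * t)).1 := by ring
        rw [this]
        split_ifs with hx
        · rw [max_eq_left hx]; linear_combination -hdβ
        · rw [max_eq_right (by linarith)]; linear_combination -hdβ
  · exfalso
    refine Prm.no_cycle_of_homog _ ?_ h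
    rintro l hl ⟨x, y⟩
    subst hβ
    have hiff : l * x ≤ 0 ↔ x ≤ 0 := by
      constructor
      · intro h; exact nonpos_of_mul_nonpos_right h hl
      · intro h; exact mul_nonpos_of_nonneg_of_nonpos hl.le h
    simp only [vecField, Prod.smul_mk, smul_eq_mul, hiff]
    ext
    · simp only; split_ifs <;> ring
    · simp only; ring
  · let P : Prm := ⟨1 + k₁, k₂ - 1, α + k₁, α - k₂, β / (α - k₂), by linarith, by linarith, hp, hq,
      div_pos hβ hq⟩
    obtain ⟨d, hd⟩ : ∃ d, d = β / (α - k₂) := ⟨_, rfl⟩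
    have hdβ : (α - k₂) * d = β := by rw [hd]; field_simp
    refine P.orbits_eq _ (fun w => (w.1 - d, w.2 + w.1 - (d - k₂ * d))) ?_ 1 (Or.inl rfl) ?_ h.1 h'.1
    · rintro ⟨x, y⟩ ⟨x', y'⟩ hxy
      simp only [Prod.mk.injEq] at hxy ⊢
      exact ⟨by linarith [hxy.1], by linarith [hxy.1, hxy.2]⟩
    · intro γ hc
      simp only [one_mul]
      have h1 : ∀ t, HasDerivAt (fun t => (γ t).1) _ t := fun t => (hc t).fst
      have h2 : ∀ t, HasDerivAt (fun t => (γ t).2) _ t := fun t => (hc t).snd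
      constructor
      · intro t
        refine ((h1 t).sub_const d).congr_deriv ?_
        simp only [vecField, Prm.F, Prm.m, P, ← hd]
        have : -((γ t).1 - d) - d = -(γ t).1 := by ring
        rw [this]
        split_ifs with hx
        · rw [max_eq_right (by linarith)]; ring
        · rw [max_eq_left (by linarith)]; ring
      · intro t
        refine (((h2 t).add (h1 t)).sub_const (d - k₂ * d)).congr_deriv ?_
        simp only [vecField, Prm.g, Prm.m, P, ← hd]
        have : -((γ t).1 - d) - d = -(γ t).1 := by ring
        rw [this]
        split_ifs with hx
        · rw [max_eq_right (by linarith)]; linear_combination -hdβ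
        · rw [max_eq_left (by linarith)]; linear_combination -hdβ
end

section
/- Let φ : ℝ → ℝ be continuous and piecewise linear with k dropping sections (slopes k₁ and −k₂), with k₁ > 0 and 0 < k₂ < 1, and let α > 0, β ∈ ℝ. Then the system ẋ = y − φ(x), ẏ = β − αx − y has no periodic orbit, i.e. there is no nonconstant periodic solution γ : ℝ → ℝ² of this system. -/
theorem pwl_mono_aux (k : ℕ) (a b : ℕ → ℝ) (ψ : ℝ → ℝ)
    (hab : ∀ i, i < k → a i < b i) (hba : ∀ i, i + 1 < k → b i < a (i + 1))
    (h1 : ∀ i, i ≤ k → ∀ x y : ℝ, x ≤ y → (i = 0 ∨ b (i - 1) ≤ x) → (i = k ∨ y ≤ a i) →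
      ψ x ≤ ψ y)
    (h2 : ∀ i, i < k → MonotoneOn ψ (Set.Icc (a i) (b i))) : Monotone ψ := by
  have key : ∀ i, i < k → MonotoneOn ψ (Set.Iic (b i)) := by
    have step : ∀ i, i < k → MonotoneOn ψ (Set.Iic (a i)) → MonotoneOn ψ (Set.Iic (b i)) := by
      intro i hi h
      have := h.union_right (h2 i hi) (c := a i) isGreatest_Iic (isLeast_Icc (hab i hi).le)
      rwa [Set.Iic_union_Icc_eq_Iic (hab i hi).le] at this
    intro i
    induction i with
    | zero =>
      intro hi
      apply step 0 hi
      intro x hx y hy hxy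
      exact h1 0 hi.le x y hxy (Or.inl rfl) (Or.inr hy)
    | succ i ih =>
      intro hi
      apply step _ hi
      have hm : MonotoneOn ψ (Set.Icc (b i) (a (i+1))) := by
        intro x hx y hy hxy
        exact h1 (i+1) hi.le x y hxy (Or.inr (by simpa using hx.1)) (Or.inr hy.2)
      have := (ih (by omega)).union_right hm (c := b i) isGreatest_Iic
        (isLeast_Icc (hba i hi).le)
      rwa [Set.Iic_union_Icc_eq_Iic (hba i hi).le] at this
  rcases Nat.eq_zero_or_pos k with hk | hk
  · intro x y hxy
    exact h1 0 (by omega) x y hxy (Or.inl rfl) (Or.inl hk.symm)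
  · have hm : MonotoneOn ψ (Set.Ici (b (k-1))) := by
      intro x hx y hy hxy
      exact h1 k le_rfl x y hxy (Or.inr hx) (Or.inl rfl)
    have := (key (k-1) (by omega)).union_right hm (c := b (k-1)) isGreatest_Iic isLeast_Ici
    rw [Set.Iic_union_Ici] at this
    exact monotoneOn_univ.1 this

open Filter Topology in
theorem energy_slope_aux (κ L : ℝ) (φ : ℝ → ℝ)
    (hlo : Monotone (fun x => φ x + κ * x)) (hL : ∀ x y, |φ x - φ y| ≤ L * |x - y|)
    (x y H : ℝ → ℝ) (t y' H' : ℝ) (hφ : Continuous φ) 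
    (hx : HasDerivAt x (y t - φ (x t)) t) (hy : HasDerivAt y y' t) (hH : HasDerivAt H H' t)
    (r : ℝ) (hr : (y t - φ (x t)) * y' + κ * (y t - φ (x t))^2 + H' < r) :
    ∀ᶠ z in 𝓝[>] t, slope (fun s => (y s - φ (x s))^2 / 2 + H s) t z < r := by
  set v := fun s => y s - φ (x s) with hv
  have hle : 𝓝[>] t ≤ 𝓝[≠] t := nhdsWithin_mono _ (fun z hz => ne_of_gt hz)
  have sx := (hasDerivAt_iff_tendsto_slope.1 hx).mono_left hle
  have sy := (hasDerivAt_iff_tendsto_slope.1 hy).mono_left hle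
  have sH := (hasDerivAt_iff_tendsto_slope.1 hH).mono_left hle
  have vc : ContinuousAt v t :=
    hy.continuousAt.sub (hφ.continuousAt.comp hx.continuousAt)
  have sv : Tendsto v (𝓝[>] t) (𝓝 (v t)) := vc.tendsto.mono_left nhdsWithin_le_nhds
  have hR : Tendsto (fun z => v t * slope y t z + κ * (v t * slope x t z)
      + |v z - v t| / 2 * (|slope y t z| + L * |slope x t z|) + slope H t z) (𝓝[>] t)
      (𝓝 (v t * y' + κ * (v t * v t) + |v t - v t| / 2 * (|y'| + L * |v t|) + H')) := by
    exact (((sy.const_mul _).add ((sx.const_mul _).const_mul _)).add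
      (((sv.sub_const _).abs.div_const 2).mul (sy.abs.add (sx.abs.const_mul L)))).add sH
  have hlt : v t * y' + κ * (v t * v t) + |v t - v t| / 2 * (|y'| + L * |v t|) + H' < r := by
    simp only [sub_self, abs_zero, zero_div, zero_mul, add_zero]
    have : v t * y' + κ * (v t * v t) + H' = v t * y' + κ * (v t)^2 + H' := by ring
    rw [this]; exact hr
  have hsign : ∀ᶠ z in 𝓝[>] t, 0 ≤ v t * slope x t z := by
    by_cases h0 : v t = 0
    · simp [h0]
    · have : Tendsto (fun z => v t * slope x t z) (𝓝[>] t) (𝓝 (v t * v t)) := sx.const_mul _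
      exact (this.eventually (lt_mem_nhds (mul_self_pos.2 h0))).mono fun z hz => hz.le
  filter_upwards [hR.eventually (gt_mem_nhds hlt), hsign, self_mem_nhdsWithin] with z hz hs hzt
  refine lt_of_le_of_lt ?_ hz
  have hd : 0 < z - t := sub_pos.2 hzt
  -- slope of φ ∘ x
  set q := slope (fun s => φ (x s)) t z with hq
  have eq1 : φ (x z) - φ (x t) = q * (z - t) := by
    rw [hq, slope_def_field]; field_simp
  have eq2 : x z - x t = slope x t z * (z - t) := by
    rw [slope_def_field]; field_simp
  have eq3 : y z - y t = slope y t z * (z - t) := by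
    rw [slope_def_field]; field_simp
  have eq4 : H z - H t = slope H t z * (z - t) := by
    rw [slope_def_field]; field_simp
  have hqL : |q| ≤ L * |slope x t z| := by
    have := hL (x z) (x t)
    rw [eq1, eq2, abs_mul, abs_mul, abs_of_pos hd, ← mul_assoc] at this
    exact le_of_mul_le_mul_right this hd
  have hqlo : 0 ≤ v t * (q + κ * slope x t z) := by
    have e : φ (x z) + κ * x z - (φ (x t) + κ * x t) = (q + κ * slope x t z) * (z - t) := by
      linear_combination eq1 + κ * eq2
    rcases lt_trichotomy (v t) 0 with h | h | h
    · have hsx : slope x t z ≤ 0 := by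
        by_contra hc; push Not at hc; nlinarith
      have : x z ≤ x t := by nlinarith
      have hm := hlo this
      simp only at hm
      have : q + κ * slope x t z ≤ 0 := by
        by_contra hc; push Not at hc; nlinarith [mul_pos hc hd]
      exact mul_nonneg_of_nonpos_of_nonpos h.le this
    · rw [h]; simp
    · have hsx : 0 ≤ slope x t z := by
        by_contra hc; push Not at hc; nlinarith
      have : x t ≤ x z := by nlinarith
      have hm := hlo this
      simp only at hm
      have : 0 ≤ q + κ * slope x t z := by
        by_contra hc; push Not at hc; nlinarith [mul_pos (neg_pos.2 hc) hd]
      exact mul_nonneg h.le this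
  have ev : v z - v t = (slope y t z - q) * (z - t) := by
    simp only [hv]; linear_combination eq3 - eq1
  have es : slope (fun s => (v s)^2 / 2 + H s) t z
      = v t * (slope y t z - q) + (v z - v t) / 2 * (slope y t z - q) + slope H t z := by
    rw [slope_def_field, div_eq_iff hd.ne']
    linear_combination eq4 + (v z + v t) / 2 * ev
  have hb : (v z - v t) / 2 * (slope y t z - q)
      ≤ |v z - v t| / 2 * (|slope y t z| + L * |slope x t z|) := by
    calc _ ≤ |(v z - v t) / 2 * (slope y t z - q)| := le_abs_self _
      _ = |v z - v t| / 2 * |slope y t z - q| := by rw [abs_mul, abs_div]; norm_num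
      _ ≤ _ := by
        gcongr
        exact (abs_sub _ _).trans (by gcongr)
  rw [es]
  nlinarith

open Filter Topology in
/-- When `0 < k₂ < 1`, system (1) has no periodic orbit. -/
theorem no_periodic_orbit_of_small_descending_slope
    (k : ℕ) (k₁ k₂ α β : ℝ) (a b : ℕ → ℝ) (φ : ℝ → ℝ)
    (hk₁ : 0 < k₁) (hk₂0 : 0 < k₂) (hk₂1 : k₂ < 1) (hα : 0 < α)
    (hφ : IsPWL k k₁ k₂ a b φ) :
    ¬ ∃ Γ : Set (ℝ × ℝ), IsPeriodicOrbit (vecField α β φ) Γ := by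
  obtain ⟨hc, hab, hba, ⟨c, hcc⟩, ⟨d, hdd⟩⟩ := hφ
  have hlo : Monotone (fun x => φ x + k₂ * x) := by
    apply pwl_mono_aux k a b _ hab hba
    · intro i hi x y hxy hx hy
      have e1 := hcc i hi x hx (hy.imp id fun h => hxy.trans h)
      have e2 := hcc i hi y (hx.imp id fun h => h.trans hxy) hy
      simp only [e1, e2]; nlinarith
    · intro i hi x hx y hy hxy
      simp only [hdd i hi x hx, hdd i hi y hy]; nlinarith
  have hhi : Monotone (fun x => k₁ * x - φ x) := by
    apply pwl_mono_aux k a b _ hab hba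
    · intro i hi x y hxy hx hy
      have e1 := hcc i hi x hx (hy.imp id fun h => hxy.trans h)
      have e2 := hcc i hi y (hx.imp id fun h => h.trans hxy) hy
      simp only [e1, e2]; nlinarith
    · intro i hi x hx y hy hxy
      simp only [hdd i hi x hx, hdd i hi y hy]; nlinarith
  have hL' : ∀ x y, x ≤ y → |φ x - φ y| ≤ (k₁ + k₂) * |x - y| := by
    intro x y h
    have m1 := hlo h
    have m2 := hhi h
    simp only at m1 m2
    rw [abs_of_nonpos (sub_nonpos.2 h), abs_le]
    constructor <;> nlinarith
  have hL : ∀ x y, |φ x - φ y| ≤ (k₁ + k₂) * |x - y| := by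
    intro x y
    rcases le_total x y with h | h
    · exact hL' x y h
    · rw [abs_sub_comm, abs_sub_comm x]; exact hL' y x h
  rintro ⟨Γ, γ, T, hT, hper, hder, ⟨t₀, ht₀⟩, -⟩
  set x := fun t => (γ t).1 with hxdef
  set y := fun t => (γ t).2 with hydef
  have hx : ∀ t, HasDerivAt x (y t - φ (x t)) t := fun t => (hder t).fst
  have hy : ∀ t, HasDerivAt y (β - α * x t - y t) t := fun t => (hder t).snd
  have xc : Continuous x := continuous_iff_continuousAt.2 fun t => (hx t).continuousAt
  have yc : Continuous y := continuous_iff_continuousAt.2 fun t => (hy t).continuousAt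
  set g := fun u : ℝ => α * u + φ u - β with hg
  have gc : Continuous g := by fun_prop
  set G := fun u : ℝ => ∫ s in (0:ℝ)..u, g s with hG
  have hGd : ∀ u, HasDerivAt G (g u) u := fun u =>
    (gc.integral_hasStrictDerivAt 0 u).hasDerivAt
  set v := fun s => y s - φ (x s) with hv
  have vc : Continuous v := by fun_prop
  have hH : ∀ t, HasDerivAt (fun s => G (x s)) (g (x t) * v t) t := fun t =>
    (hGd (x t)).comp t (hx t)
  set E := fun s => (y s - φ (x s))^2 / 2 + G (x s) with hE
  have Ec : Continuous E := by
    have : Continuous (fun s => G (x s)) :=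
      continuous_iff_continuousAt.2 fun t => (hH t).continuousAt
    fun_prop
  set w := fun s => v s ^ 2 with hw
  have wc : Continuous w := by fun_prop
  have wint : ∀ p q, IntervalIntegrable w MeasureTheory.volume p q :=
    fun p q => wc.intervalIntegrable p q
  set B := fun t => E 0 - (1 - k₂) * ∫ s in (0:ℝ)..t, w s with hB
  have hBd : ∀ t, HasDerivAt B (-((1 - k₂) * w t)) t := fun t =>
    (((wc.integral_hasStrictDerivAt 0 t).hasDerivAt).const_mul (1 - k₂)).const_sub _
  have hET : E T ≤ B T := by
    refine image_le_of_liminf_slope_right_le_deriv_boundary (f := E) (a := 0) (b := T) (B := B)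
      (B' := fun t => -((1 - k₂) * w t)) Ec.continuousOn (by simp [hB])
      (fun t _ => (hBd t).continuousAt.continuousWithinAt)
      (fun t _ => (hBd t).hasDerivWithinAt) ?_ (Set.right_mem_Icc.2 hT.le)
    intro t _ r hr
    refine (energy_slope_aux k₂ (k₁ + k₂) φ hlo hL x y (fun s => G (x s)) t _ _ hc (hx t) (hy t)
      (hH t) r (lt_of_eq_of_lt ?_ hr)).frequently
    simp only [hw, hv, hg]; ring
  have hE0 : E T = E 0 := by
    have := hper 0
    rw [zero_add] at this
    simp only [hE, hxdef, hydef, this]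
  have hint : ∫ s in (0:ℝ)..T, w s ≤ 0 := by
    rw [hE0] at hET
    simp only [hB] at hET
    by_contra hcon
    push Not at hcon
    nlinarith [mul_pos (sub_pos.2 hk₂1) hcon]
  have hv0 : ∀ t ∈ Set.Icc 0 T, v t = 0 := by
    intro t ht
    by_contra hne
    have : 0 < ∫ s in (0:ℝ)..T, w s :=
      intervalIntegral.integral_pos hT wc.continuousOn (fun s _ => sq_nonneg _)
        ⟨t, ht, by positivity⟩
    linarith
  have hvper : Function.Periodic v T := by
    intro t
    simp only [hv, hxdef, hydef, hper]
  have hvz : ∀ t, v t = 0 := by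
    intro t
    obtain ⟨s, hs, hst⟩ := hvper.exists_mem_Ico₀ hT t
    rw [hst]; exact hv0 s ⟨hs.1, hs.2.le⟩
  have hxc : ∀ t, x t = x 0 := fun t =>
    is_const_of_deriv_eq_zero (fun s => (hx s).differentiableAt)
      (fun s => by rw [(hx s).deriv]; exact hvz s) t 0
  have hyc : y t₀ = y 0 := by
    have h1 := hvz t₀
    have h2 := hvz 0
    simp only [hv] at h1 h2
    rw [hxc t₀] at h1
    linarith
  exact ht₀ (Prod.ext (hxc t₀) hyc)
end

section
/- Let φ : ℝ → ℝ be continuous and piecewise linear with k dropping sections (slopes k₁ and −k₂), with k₁ > 0 and k₂ > 0, and let α > 0 with α ≠ k₂, β ∈ ℝ. Then the set of singular points of the system ẋ = y − φ(x), ẏ = β − αx − y, i.e. the set {(x,y) ∈ ℝ² : y = φ(x) and y = β − αx}, is finite and has at most 2k+1 elements. -/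
/-- For `α > 0`, `α ≠ k₂`, the set of singular points of system (1) is finite,
with at most `2k+1` elements. -/
theorem singular_points_finite_card_le
    (k : ℕ) (k₁ k₂ α β : ℝ) (a b : ℕ → ℝ) (φ : ℝ → ℝ)
    (hk₁ : 0 < k₁) (hk₂ : 0 < k₂) (hα : 0 < α) (hαk₂ : α ≠ k₂)
    (hφ : IsPWL k k₁ k₂ a b φ) :
    {p : ℝ × ℝ | p.2 = φ p.1 ∧ p.2 = β - α * p.1}.Finite ∧
      {p : ℝ × ℝ | p.2 = φ p.1 ∧ p.2 = β - α * p.1}.ncard ≤ 2 * k + 1 := by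
  classical
  obtain ⟨-, -, -, ⟨c, hc⟩, ⟨d, hd⟩⟩ := hφ
  set S : Set (ℝ × ℝ) := {p : ℝ × ℝ | p.2 = φ p.1 ∧ p.2 = β - α * p.1} with hS
  let g : ℝ → ℝ × ℝ := fun x => (x, β - α * x)
  let T : Finset (ℝ × ℝ) :=
    (Finset.range (k + 1)).image (fun i => g ((β - c i) / (k₁ + α))) ∪
      (Finset.range k).image (fun i => g ((β - d i) / (α - k₂)))
  have hT : T.card ≤ 2 * k + 1 := by
    refine (Finset.card_union_le _ _).trans ?_
    have h1 := Finset.card_image_le (s := Finset.range (k + 1))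
      (f := fun i => g ((β - c i) / (k₁ + α)))
    have h2 := Finset.card_image_le (s := Finset.range k)
      (f := fun i => g ((β - d i) / (α - k₂)))
    rw [Finset.card_range] at h1 h2
    omega
  have hne : k₁ + α ≠ 0 := by positivity
  have hne2 : α - k₂ ≠ 0 := sub_ne_zero.mpr hαk₂
  have hsub : S ⊆ (T : Set (ℝ × ℝ)) := by
    rintro ⟨x, y⟩ ⟨h1, h2⟩
    simp only at h1 h2
    have key1 : ∀ i, i ≤ k → φ x = k₁ * x + c i → (x, y) ∈ T := by
      intro i hi h
      refine Finset.mem_union_left _ (Finset.mem_image.mpr ⟨i, by simp; omega, ?_⟩)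
      have hx : (β - c i) / (k₁ + α) = x := by
        rw [div_eq_iff hne]; linarith
      simp only [g, hx, h2]
    have key2 : ∀ i, i < k → φ x = -k₂ * x + d i → (x, y) ∈ T := by
      intro i hi h
      refine Finset.mem_union_right _ (Finset.mem_image.mpr ⟨i, by simp; omega, ?_⟩)
      have hx : (β - d i) / (α - k₂) = x := by
        rw [div_eq_iff hne2]; linarith
      simp only [g, hx, h2]
    have step : ∀ j, j ≤ k → (x, y) ∈ T ∨ (j = 0 ∨ b (j - 1) ≤ x) := by
      intro j
      induction j with
      | zero => intro _; exact Or.inr (Or.inl rfl)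
      | succ j ih =>
        intro hj
        rcases ih (by omega) with h | h
        · exact Or.inl h
        · rcases le_total x (a j) with ha | ha
          · exact Or.inl (key1 j (by omega) (hc j (by omega) x h (Or.inr ha)))
          · rcases le_total x (b j) with hb | hb
            · exact Or.inl (key2 j (by omega) (hd j (by omega) x ⟨ha, hb⟩))
            · exact Or.inr (Or.inr (by simpa using hb))
    rcases step k le_rfl with h | h
    · exact h
    · exact key1 k le_rfl (hc k le_rfl x h (Or.inl rfl))
  refine ⟨T.finite_toSet.subset hsub, ?_⟩
  have := Set.ncard_le_ncard hsub T.finite_toSet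
  rw [Set.ncard_coe_finset] at this
  exact this.trans hT
end

section
/- Let σ ∈ ℝ and ω > 0. Then the function ζ(τ) = (ω·cos(ωτ) − σ·sin(ωτ) − ω·e^{−στ}) / sin(ωτ) is strictly decreasing on the open interval (0, π/ω). -/
/-- Monotonicity of the return-map ingredient
`ζ(τ) = (ω cos ωτ - σ sin ωτ - ω e^{-στ}) / sin ωτ` on `(0, π/ω)`. -/
theorem zeta_strict_anti (σ ω : ℝ) (hω : 0 < ω) :
    StrictAntiOn
      (fun τ : ℝ =>
        (ω * Real.cos (ω * τ) - σ * Real.sin (ω * τ) - ω * Real.exp (-σ * τ)) /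
          Real.sin (ω * τ))
      (Set.Ioo 0 (Real.pi / ω)) := by
  have hpos : ∀ τ ∈ Set.Ioo 0 (Real.pi / ω), 0 < Real.sin (ω * τ) := by
    intro τ hτ
    apply Real.sin_pos_of_pos_of_lt_pi (mul_pos hω hτ.1)
    have := (lt_div_iff₀ hω).1 hτ.2
    linarith
  have hl : ∀ k τ : ℝ, HasDerivAt (fun t : ℝ => k * t) k τ := fun k τ => by
    simpa using (hasDerivAt_id τ).const_mul k
  have hs : ∀ τ : ℝ, HasDerivAt (fun t => Real.sin (ω * t)) (Real.cos (ω * τ) * ω) τ :=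
    fun τ => (hl ω τ).sin
  have hc : ∀ τ : ℝ, HasDerivAt (fun t => Real.cos (ω * t)) (-Real.sin (ω * τ) * ω) τ :=
    fun τ => (hl ω τ).cos
  have he : ∀ τ : ℝ, HasDerivAt (fun t => Real.exp (-σ * t)) (Real.exp (-σ * τ) * (-σ)) τ :=
    fun τ => (hl (-σ) τ).exp
  have hh : ∀ τ : ℝ, HasDerivAt
      (fun t => Real.exp (-σ * t) * (σ * Real.sin (ω * t) + ω * Real.cos (ω * t)))
      (-((σ ^ 2 + ω ^ 2) * Real.sin (ω * τ) * Real.exp (-σ * τ))) τ := fun τ =>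
    ((he τ).mul (((hs τ).const_mul σ).add ((hc τ).const_mul ω))).congr_deriv (by
      simp only [Pi.add_apply]; ring)
  have hanti : StrictAntiOn
      (fun t => Real.exp (-σ * t) * (σ * Real.sin (ω * t) + ω * Real.cos (ω * t)))
      (Set.Icc 0 (Real.pi / ω)) := by
    apply strictAntiOn_of_deriv_neg (convex_Icc _ _)
    · exact fun τ _ => (hh τ).continuousAt.continuousWithinAt
    · intro τ hτ
      rw [interior_Icc] at hτ
      rw [(hh τ).deriv]
      have := hpos τ hτ
      have := Real.exp_pos (-σ * τ)
      have : 0 < σ ^ 2 + ω ^ 2 := by positivity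
      rw [neg_lt_zero]
      positivity
  have hd : ∀ τ ∈ Set.Ioo 0 (Real.pi / ω), HasDerivAt (fun τ : ℝ =>
        (ω * Real.cos (ω * τ) - σ * Real.sin (ω * τ) - ω * Real.exp (-σ * τ)) /
          Real.sin (ω * τ))
      (ω * (Real.exp (-σ * τ) * (σ * Real.sin (ω * τ) + ω * Real.cos (ω * τ)) - ω)
        / Real.sin (ω * τ) ^ 2) τ := by
    intro τ hτ
    refine (((((hc τ).const_mul ω).sub ((hs τ).const_mul σ)).sub
      ((he τ).const_mul ω)).div (hs τ) (hpos τ hτ).ne').congr_deriv ?_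
    simp only [Pi.sub_apply]
    congr 1
    linear_combination (-ω ^ 2) * Real.sin_sq_add_cos_sq (ω * τ)
  apply strictAntiOn_of_deriv_neg (convex_Ioo _ _)
  · exact fun τ hτ => (hd τ hτ).continuousAt.continuousWithinAt
  · intro τ hτ
    rw [interior_Ioo] at hτ
    rw [(hd τ hτ).deriv]
    have h1 := hpos τ hτ
    have h2 := hanti ⟨le_rfl, (hτ.1.trans hτ.2).le⟩ ⟨hτ.1.le, hτ.2.le⟩ hτ.1
    simp only [mul_zero, Real.exp_zero, Real.sin_zero, Real.cos_zero, mul_one, one_mul,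
      zero_add] at h2
    apply div_neg_of_neg_of_pos _ (by positivity)
    exact mul_neg_of_pos_of_neg hω (by linarith)
end
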